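/- Iteration bound for the asynchronous Sinkhorn algorithm: with the initialization v⁰(y) = 1 for all y ∈ Y, the following hold: (a) Σ_{x∈X} u^ℓ(x)·μ(x) ≤ exp(C/ε) for every ℓ ≥ 1; (b) for every q_target ∈ (0,1) there exists a natural number n with n ≤ 2 + C/(ε·(1 − q_target)) such that q^n ≥ q_target. -/

import Mathlib

/-- One `u`-update of the Sinkhorn algorithm: `u(x) = μ(x) / Σ_y K(x,y) v(y)`. -/
noncomputable def uOf {X Y : Type*} [Fintype Y] (K : X → Y → ℝ) (μ : X → ℝ)
    (v : Y → ℝ) : X → ℝ :=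
  fun x => μ x / ∑ y, K x y * v y

/-- One `v̂`-update of the Sinkhorn algorithm: `v̂(y) = ν(y) / Σ_x K(x,y) u(x)`. -/
noncomputable def vhatOf {X Y : Type*} [Fintype X] (K : X → Y → ℝ) (ν : Y → ℝ)
    (u : X → ℝ) : Y → ℝ :=
  fun y => ν y / ∑ x, K x y * u x

/-- The `v`-iterates of the asynchronous Sinkhorn algorithm:
`v⁰ = v0`, `v^{ℓ+1}(y) = min (v^ℓ(y), v̂^{ℓ+1}(y))` with
`v̂^{ℓ+1} = vhatOf K ν (uOf K μ (v^ℓ))`. -/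
noncomputable def sinkV {X Y : Type*} [Fintype X] [Fintype Y] (K : X → Y → ℝ)
    (μ : X → ℝ) (ν : Y → ℝ) (v0 : Y → ℝ) : ℕ → Y → ℝ
  | 0 => v0
  | ℓ + 1 => fun y =>
      min (sinkV K μ ν v0 ℓ y) (vhatOf K ν (uOf K μ (sinkV K μ ν v0 ℓ)) y)

section Sinkhorn

variable {X Y : Type*} {K : X → Y → ℝ} {μ : X → ℝ} {ν v0 : Y → ℝ}

theorem uOf_pos [Fintype Y] [Nonempty Y]
    (hK : ∀ x y, 0 < K x y) (hμ : ∀ x, 0 < μ x) {v : Y → ℝ} (hv : ∀ y, 0 < v y)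
    (x : X) : 0 < uOf K μ v x :=
  div_pos (hμ x) (Finset.sum_pos (fun y _ => mul_pos (hK x y) (hv y)) Finset.univ_nonempty)

theorem vhatOf_pos [Fintype X] [Nonempty X]
    (hK : ∀ x y, 0 < K x y) (hν : ∀ y, 0 < ν y) {u : X → ℝ} (hu : ∀ x, 0 < u x)
    (y : Y) : 0 < vhatOf K ν u y :=
  div_pos (hν y) (Finset.sum_pos (fun x _ => mul_pos (hK x y) (hu x)) Finset.univ_nonempty)

theorem uOf_le_uOf [Fintype Y] [Nonempty Y]
    (hK : ∀ x y, 0 < K x y) (hμ : ∀ x, 0 < μ x) {v w : Y → ℝ}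
    (hv : ∀ y, 0 < v y) (hvw : ∀ y, v y ≤ w y) (x : X) : uOf K μ w x ≤ uOf K μ v x :=
  div_le_div_of_nonneg_left (hμ x).le
    (Finset.sum_pos (fun y _ => mul_pos (hK x y) (hv y)) Finset.univ_nonempty)
    (Finset.sum_le_sum fun y _ => mul_le_mul_of_nonneg_left (hvw y) (hK x y).le)

theorem sinkV_pos [Fintype X] [Fintype Y] [Nonempty X] [Nonempty Y]
    (hK : ∀ x y, 0 < K x y) (hμ : ∀ x, 0 < μ x) (hν : ∀ y, 0 < ν y)
    (hv0 : ∀ y, 0 < v0 y) (ℓ : ℕ) (y : Y) : 0 < sinkV K μ ν v0 ℓ y := by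
  induction ℓ generalizing y with
  | zero => exact hv0 y
  | succ ℓ ih => exact lt_min (ih y) (vhatOf_pos hK hν (uOf_pos hK hμ ih) y)

theorem sinkV_succ_le [Fintype X] [Fintype Y]
    (ℓ : ℕ) (y : Y) : sinkV K μ ν v0 (ℓ + 1) y ≤ sinkV K μ ν v0 ℓ y :=
  min_le_left _ _

/-- The `u`-update makes the row marginals equal to `μ`. -/
theorem uOf_mul_sum [Fintype Y] [Nonempty Y]
    (hK : ∀ x y, 0 < K x y) {v : Y → ℝ} (hv : ∀ y, 0 < v y) (x : X) :
    uOf K μ v x * ∑ y, K x y * v y = μ x :=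
  div_mul_cancel₀ _
    (Finset.sum_pos (fun y _ => mul_pos (hK x y) (hv y)) Finset.univ_nonempty).ne'

/-- The column marginals after a `u`-update have the same total mass as `μ`. -/
theorem sum_mul_sum_uOf [Fintype X] [Fintype Y] [Nonempty Y]
    (hK : ∀ x y, 0 < K x y) {v : Y → ℝ} (hv : ∀ y, 0 < v y) :
    ∑ y, v y * ∑ x, K x y * uOf K μ v x = ∑ x, μ x := by
  simp_rw [Finset.mul_sum]
  rw [Finset.sum_comm]
  refine Finset.sum_congr rfl fun x _ => ?_
  rw [← uOf_mul_sum (μ := μ) hK hv x, Finset.mul_sum]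
  exact Finset.sum_congr rfl fun y _ => by ring

/-- A coordinate that has already been lowered has column marginal at least `ν`. -/
theorem sinkV_eq_or_le_marginal [Fintype X] [Fintype Y] [Nonempty X] [Nonempty Y]
    (hK : ∀ x y, 0 < K x y) (hμ : ∀ x, 0 < μ x) (hν : ∀ y, 0 < ν y)
    (hv0 : ∀ y, 0 < v0 y) (ℓ : ℕ) (y : Y) :
    sinkV K μ ν v0 ℓ y = v0 y ∨
      ν y ≤ sinkV K μ ν v0 ℓ y * ∑ x, K x y * uOf K μ (sinkV K μ ν v0 ℓ) x := by
  induction ℓ with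
  | zero => exact Or.inl rfl
  | succ ℓ ih =>
    have hpos := sinkV_pos hK hμ hν hv0
    have hmono : ∑ x, K x y * uOf K μ (sinkV K μ ν v0 ℓ) x ≤
        ∑ x, K x y * uOf K μ (sinkV K μ ν v0 (ℓ + 1)) x :=
      Finset.sum_le_sum fun x _ => mul_le_mul_of_nonneg_left
        (uOf_le_uOf hK hμ (hpos (ℓ + 1)) (sinkV_succ_le ℓ) x) (hK x y).le
    have hstep := mul_le_mul_of_nonneg_left hmono (hpos (ℓ + 1) y).le
    have hmin : sinkV K μ ν v0 (ℓ + 1) y = min (sinkV K μ ν v0 ℓ y)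
        (vhatOf K ν (uOf K μ (sinkV K μ ν v0 ℓ)) y) := rfl
    rcases min_choice (sinkV K μ ν v0 ℓ y)
        (vhatOf K ν (uOf K μ (sinkV K μ ν v0 ℓ)) y) with h | h
    · rw [← hmin] at h
      refine ih.imp h.trans fun ih => ih.trans ?_
      rwa [h] at hstep ⊢
    · rw [← hmin] at h
      refine Or.inr (le_trans (le_of_eq ?_) hstep)
      rw [h]
      exact (div_mul_cancel₀ _ (Finset.sum_pos (fun x _ => mul_pos (hK x y)
        (uOf_pos hK hμ (hpos ℓ) x)) Finset.univ_nonempty).ne').symm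

/-- Some coordinate of `v` is never lowered. -/
theorem exists_sinkV_eq [Fintype X] [Fintype Y] [Nonempty X] [Nonempty Y]
    (hK : ∀ x y, 0 < K x y) (hμ : ∀ x, 0 < μ x) (hν : ∀ y, 0 < ν y)
    (hv0 : ∀ y, 0 < v0 y) (hmass : ∑ x, μ x = ∑ y, ν y) (ℓ : ℕ) :
    ∃ y, sinkV K μ ν v0 ℓ y = v0 y := by
  induction ℓ with
  | zero => exact ⟨Classical.arbitrary Y, rfl⟩
  | succ ℓ ih =>
    by_contra! hne
    obtain ⟨y₀, hy₀⟩ := ih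
    have hpos := sinkV_pos hK hμ hν hv0
    have hlt : ∀ y, sinkV K μ ν v0 ℓ y = v0 y →
        ν y < sinkV K μ ν v0 ℓ y * ∑ x, K x y * uOf K μ (sinkV K μ ν v0 ℓ) x := by
      intro y hy
      have hS : 0 < ∑ x, K x y * uOf K μ (sinkV K μ ν v0 ℓ) x :=
        Finset.sum_pos (fun x _ => mul_pos (hK x y) (uOf_pos hK hμ (hpos ℓ) x))
          Finset.univ_nonempty
      by_contra! hle
      exact hne y ((min_eq_left ((le_div_iff₀ hS).2 hle)).trans hy)
    refine (Finset.sum_lt_sum (s := Finset.univ) (fun y _ => ?_)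
      ⟨y₀, Finset.mem_univ _, hlt y₀ hy₀⟩).ne
      (hmass.symm.trans (sum_mul_sum_uOf (μ := μ) hK (hpos ℓ)).symm)
    exact (sinkV_eq_or_le_marginal hK hμ hν hv0 ℓ y).elim (fun h => (hlt y h).le) id

/-- The `μ`-average of `log u` increases by at least the missing mass. -/
theorem sum_mul_log_uOf_succ [Fintype X] [Fintype Y] [Nonempty Y]
    (hK : ∀ x y, 0 < K x y) (hμ : ∀ x, 0 < μ x) {v w : Y → ℝ}
    (hv : ∀ y, 0 < v y) (hw : ∀ y, 0 < w y) :
    ∑ x, μ x * Real.log (uOf K μ v x) +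
        (∑ x, μ x - ∑ x, ∑ y, uOf K μ v x * K x y * w y) ≤
      ∑ x, μ x * Real.log (uOf K μ w x) := by
  rw [← Finset.sum_sub_distrib, ← Finset.sum_add_distrib]
  refine Finset.sum_le_sum fun x _ => ?_
  have hu := uOf_pos hK hμ hv x
  have hu' := uOf_pos hK hμ hw x
  have hm := hμ x
  have hrow : ∑ y, uOf K μ v x * K x y * w y = uOf K μ v x * (μ x / uOf K μ w x) := by
    rw [← uOf_mul_sum (μ := μ) hK hw x, mul_div_cancel_left₀ _ hu'.ne', Finset.mul_sum]
    exact Finset.sum_congr rfl fun y _ => by ring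
  have hlog := Real.log_le_sub_one_of_pos (div_pos hu hu')
  rw [Real.log_div hu.ne' hu'.ne'] at hlog
  rw [hrow]
  have := mul_le_mul_of_nonneg_left hlog hm.le
  have e : uOf K μ v x * (μ x / uOf K μ w x) = μ x * (uOf K μ v x / uOf K μ w x) := by ring
  rw [e]
  linarith

end Sinkhorn

/-- Jensen's inequality for `log`, in the form `∑ p log u ≤ a` if `∑ u p ≤ exp a`. -/
theorem sum_mul_log_le_of_sum_le_exp {X : Type*} [Fintype X] {p u : X → ℝ} (hp : ∀ x, 0 < p x)
    (hp1 : ∑ x, p x = 1) (hu : ∀ x, 0 < u x) {a : ℝ} (h : ∑ x, u x * p x ≤ Real.exp a) :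
    ∑ x, p x * Real.log (u x) ≤ a := by
  have hx : ∀ x, p x * Real.log (u x) ≤ p x * (a - 1) + u x * p x * (Real.exp a)⁻¹ := by
    intro x
    have hlog := Real.log_le_sub_one_of_pos (div_pos (hu x) (Real.exp_pos a))
    rw [Real.log_div (hu x).ne' (Real.exp_pos a).ne', Real.log_exp, div_eq_mul_inv] at hlog
    have := mul_le_mul_of_nonneg_left hlog (hp x).le
    linarith
  have hs := Finset.sum_le_sum fun x (_ : x ∈ Finset.univ) => hx x
  rw [Finset.sum_add_distrib, ← Finset.sum_mul, ← Finset.sum_mul, hp1] at hs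
  have h1 : (∑ x, u x * p x) * (Real.exp a)⁻¹ ≤ 1 := by
    rw [← div_eq_mul_inv]
    exact (div_le_one (Real.exp_pos a)).2 h
  linarith

theorem async_sinkhorn_iteration_bound
    {X Y : Type*} [Fintype X] [Fintype Y] [Nonempty X] [Nonempty Y]
    (μ : X → ℝ) (ν : Y → ℝ) (hμ : ∀ x, 0 < μ x) (hν : ∀ y, 0 < ν y)
    (hμ1 : ∑ x, μ x = 1) (hν1 : ∑ y, ν y = 1)
    (C : ℝ) (hC : 0 ≤ C) (c : X → Y → ℝ) (hc : ∀ x y, 0 ≤ c x y ∧ c x y ≤ C)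
    (ε : ℝ) (hε : 0 < ε)
    (K : X → Y → ℝ) (hK : ∀ x y, K x y = Real.exp (-(c x y) / ε) * μ x * ν y)
    (v0 : Y → ℝ) (hv0 : ∀ y, v0 y = 1)
    (v : ℕ → Y → ℝ) (hv : ∀ ℓ, v ℓ = sinkV K μ ν v0 ℓ)
    (u : ℕ → X → ℝ) (hu : ∀ ℓ, u ℓ = uOf K μ (v (ℓ - 1)))
    (vhat : ℕ → Y → ℝ) (hvhat : ∀ ℓ, vhat ℓ = vhatOf K ν (u ℓ))
    (π : ℕ → X → Y → ℝ) (hπ : ∀ ℓ x y, π ℓ x y = u ℓ x * K x y * v ℓ y)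
    (q : ℕ → ℝ) (hq : ∀ ℓ, q ℓ = ∑ x, ∑ y, π ℓ x y)
    (α : ℕ → X → ℝ) (hα : ∀ ℓ x, α ℓ x = ε * Real.log (u ℓ x)) :
    (∀ ℓ : ℕ, 1 ≤ ℓ → ∑ x, u ℓ x * μ x ≤ Real.exp (C / ε)) ∧
    (∀ qt : ℝ, 0 < qt → qt < 1 →
      ∃ n : ℕ, 1 ≤ n ∧ (n : ℝ) ≤ 2 + C / (ε * (1 - qt)) ∧ qt ≤ q n) := by
  have hKpos : ∀ x y, 0 < K x y := fun x y => by
    rw [hK]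
    exact mul_pos (mul_pos (Real.exp_pos _) (hμ x)) (hν y)
  have hv0pos : ∀ y, 0 < v0 y := fun y => by rw [hv0]; exact one_pos
  have hvpos : ∀ ℓ y, 0 < v ℓ y := fun ℓ y => by
    rw [hv]; exact sinkV_pos hKpos hμ hν hv0pos ℓ y
  have husucc : ∀ ℓ, u (ℓ + 1) = uOf K μ (v ℓ) := fun ℓ => hu (ℓ + 1)
  have hupos : ∀ ℓ x, 0 < u ℓ x := fun ℓ x => by
    rw [hu]; exact uOf_pos hKpos hμ (hvpos _) x
  have hbound : ∀ ℓ, ∑ x, u (ℓ + 1) x * μ x ≤ Real.exp (C / ε) := by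
    intro ℓ
    obtain ⟨y, hy⟩ := exists_sinkV_eq hKpos hμ hν hv0pos (hμ1.trans hν1.symm) (ℓ + 1)
    have hle : 1 ≤ vhatOf K ν (u (ℓ + 1)) y := by
      rw [husucc, hv, ← hv0 y, ← hy]
      exact min_le_right _ _
    have hS : 0 < ∑ x, K x y * u (ℓ + 1) x :=
      Finset.sum_pos (fun x _ => mul_pos (hKpos x y) (hupos _ x)) Finset.univ_nonempty
    have hcol : ∑ x, K x y * u (ℓ + 1) x ≤ ν y := (one_le_div hS).1 hle
    have hlow : (∑ x, u (ℓ + 1) x * μ x) * (Real.exp (-(C / ε)) * ν y) ≤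
        ∑ x, K x y * u (ℓ + 1) x := by
      rw [Finset.sum_mul]
      refine Finset.sum_le_sum fun x _ => ?_
      have hexp : Real.exp (-(C / ε)) ≤ Real.exp (-(c x y) / ε) := by
        rw [Real.exp_le_exp, ← neg_div]
        exact div_le_div_of_nonneg_right (neg_le_neg (hc x y).2) hε.le
      have := mul_le_mul_of_nonneg_right hexp
        (mul_pos (mul_pos (hupos (ℓ + 1) x) (hμ x)) (hν y)).le
      rw [hK]
      linarith
    have hfin : (∑ x, u (ℓ + 1) x * μ x) * Real.exp (-(C / ε)) ≤ 1 := by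
      refine le_of_mul_le_mul_right ?_ (hν y)
      linarith
    rwa [Real.exp_neg, ← div_eq_mul_inv, div_le_one (Real.exp_pos _)] at hfin
  refine ⟨fun ℓ hℓ => ?_, fun qt _ hqt1 => ?_⟩
  · obtain ⟨k, rfl⟩ := Nat.exists_eq_add_of_le' hℓ
    exact hbound k
  · by_contra! hcon
    have hinit : 0 ≤ ∑ x, μ x * Real.log (u 1 x) := by
      refine Finset.sum_nonneg fun x _ => mul_nonneg (hμ x).le (Real.log_nonneg ?_)
      have hS : 0 < ∑ y, K x y * v 0 y :=
        Finset.sum_pos (fun y _ => mul_pos (hKpos x y) (hvpos 0 y)) Finset.univ_nonempty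
      rw [husucc 0]
      refine (one_le_div hS).2 ?_
      calc ∑ y, K x y * v 0 y ≤ ∑ y, μ x * ν y := by
            refine Finset.sum_le_sum fun y _ => ?_
            have hexp : Real.exp (-(c x y) / ε) ≤ 1 :=
              Real.exp_le_one_iff.2
                (div_nonpos_of_nonpos_of_nonneg (neg_nonpos.2 (hc x y).1) hε.le)
            have h1 : v 0 y = 1 := by rw [hv]; exact hv0 y
            rw [h1, mul_one, hK, mul_assoc]
            exact mul_le_of_le_one_left (mul_pos (hμ x) (hν y)).le hexp
        _ = μ x := by rw [← Finset.mul_sum, hν1, mul_one]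
    have hstep : ∀ ℓ, ∑ x, μ x * Real.log (u (ℓ + 1) x) + (1 - q (ℓ + 1)) ≤
        ∑ x, μ x * Real.log (u (ℓ + 2) x) := by
      intro ℓ
      simp_rw [hq, hπ]
      rw [husucc, husucc, ← hμ1]
      exact sum_mul_log_uOf_succ hKpos hμ (hvpos _) (hvpos _)
    set D := C / (ε * (1 - qt)) with hD
    have hgap : 0 < 1 - qt := sub_pos.2 hqt1
    have hD0 : 0 ≤ D := div_nonneg hC (mul_pos hε hgap).le
    have hgrow : ∀ N : ℕ, (N : ℝ) ≤ 2 + D →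
        N * (1 - qt) ≤ ∑ x, μ x * Real.log (u (N + 1) x) := by
      intro N
      induction N with
      | zero => intro _; simpa using hinit
      | succ N ih =>
        intro hN
        have hqN := hcon (N + 1) (Nat.le_add_left 1 N) hN
        have hprev := ih (by push_cast at hN; linarith)
        have := hstep N
        push_cast
        linarith
    have hfloor := Nat.floor_le hD0
    have hlt := Nat.lt_floor_add_one D
    have hN := hgrow (⌊D⌋₊ + 1) (by push_cast; linarith)
    have hupper := sum_mul_log_le_of_sum_le_exp hμ hμ1 (hupos (⌊D⌋₊ + 1 + 1))
      (hbound (⌊D⌋₊ + 1))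
    have hDmul : D * (1 - qt) = C / ε := by
      rw [hD]
      field_simp
    have := mul_lt_mul_of_pos_right hlt hgap
    push_cast at hN
    linarith
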